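/- Let α = (a_1, …, a_r) ∈ (B_n)^r, let J = (inf(a_1), …, inf(a_r)) ∈ ℤ^r, and let β ∈ C^{inf}(α). Then there exists a finite chain of tuples α = α_1, α_2, …, α_{k+1} = β, all lying in C^{inf}(α), and simple elements s_1, …, s_k such that s_j^{-1} α_j s_j = α_{j+1} for every j = 1, …, k, where each s_j belongs to S_{α_j, J}, i.e. s_j is ≼-minimal among the nontrivial simple elements conjugating α_j into C_J. -/

import Mathlib

/-- The braid relations on `n` strands, with Artin generators indexed by `Fin (n-1)`:
`σᵢ σⱼ σᵢ = σⱼ σᵢ σⱼ` when `|i - j| = 1`, and `σᵢ σⱼ = σⱼ σᵢ` when `|i - j| ≥ 2`. -/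
def braidRels (n : ℕ) : Set (FreeGroup (Fin (n - 1))) :=
  {w | (∃ i j : Fin (n - 1), (i : ℕ) + 1 = (j : ℕ) ∧
          w = FreeGroup.of i * FreeGroup.of j * FreeGroup.of i *
              (FreeGroup.of j * FreeGroup.of i * FreeGroup.of j)⁻¹) ∨
       (∃ i j : Fin (n - 1), (i : ℕ) + 1 < (j : ℕ) ∧
          w = FreeGroup.of i * FreeGroup.of j * (FreeGroup.of j * FreeGroup.of i)⁻¹)}

/-- The braid group `B_n` on `n` strands. -/
abbrev BraidGroup (n : ℕ) := PresentedGroup (braidRels n)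

/-- The Artin generator `σᵢ` of the braid group. -/
def braidGen (n : ℕ) (i : Fin (n - 1)) : BraidGroup n := PresentedGroup.of i

/-- The monoid `B_n⁺` of positive braids: products of the generators with no inverses. -/
def PosBraid (n : ℕ) : Submonoid (BraidGroup n) :=
  Submonoid.closure (Set.range (braidGen n))

/-- Prefix order (left-divisibility): `a ≼ b` iff `a * c = b` for some positive `c`. -/
def PrefixLE (n : ℕ) (a b : BraidGroup n) : Prop :=
  ∃ c ∈ PosBraid n, a * c = b

/-- The Garside half-twist `Δ = (σ₁)(σ₂σ₁)⋯(σ_{n-1}⋯σ₁)`. -/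
def braidDelta (n : ℕ) : BraidGroup n :=
  ((List.finRange (n - 1)).map (fun k =>
      ((((List.finRange (n - 1)).filter (fun i => decide (i ≤ k))).reverse.map
        (braidGen n)).prod))).prod

/-- A simple element (permutation braid): a positive braid left-dividing `Δ`. -/
def IsSimple (n : ℕ) (s : BraidGroup n) : Prop :=
  s ∈ PosBraid n ∧ PrefixLE n s (braidDelta n)

/-- `InfGE n j a` means `inf(a) ≥ j`, i.e. `a = Δ^j p` for some positive braid `p`. -/
def InfGE (n : ℕ) (j : ℤ) (a : BraidGroup n) : Prop :=
  ∃ p ∈ PosBraid n, a = braidDelta n ^ j * p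

/-- `β ∈ C^inf(α)`: `inf(β i) ≥ inf(α i)` for all `i` and `β` is simultaneously
conjugate to `α`. -/
def CInf (n r : ℕ) (α β : Fin r → BraidGroup n) : Prop :=
  (∀ i, ∀ j : ℤ, InfGE n j (α i) → InfGE n j (β i)) ∧
  ∃ ω : BraidGroup n, ∀ i, β i = ω⁻¹ * α i * ω

/-- `δ ∈ C_J`: `inf(δ i) ≥ J i` for all `i`. -/
def CJ (n r : ℕ) (J : Fin r → ℤ) (δ : Fin r → BraidGroup n) : Prop :=
  ∀ i, InfGE n (J i) (δ i)

/-- Property `P(δ,J)` for a braid `s`: `inf(s⁻¹ δᵢ s) ≥ J i` for all `i`,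
i.e. `s⁻¹ δ s ∈ C_J`. -/
def PropP (n r : ℕ) (J : Fin r → ℤ) (δ : Fin r → BraidGroup n) (s : BraidGroup n) : Prop :=
  ∀ i, InfGE n (J i) (s⁻¹ * δ i * s)

/-- `s ∈ S_{δ,J}`: `s` is ≼-minimal among the nontrivial simple elements
satisfying `P(δ,J)`. -/
def MinSimple (n r : ℕ) (J : Fin r → ℤ) (δ : Fin r → BraidGroup n) (s : BraidGroup n) : Prop :=
  IsSimple n s ∧ s ≠ 1 ∧ PropP n r J δ s ∧
    ∀ t : BraidGroup n, IsSimple n t → t ≠ 1 → PropP n r J δ t → PrefixLE n t s → t = s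

/-- `d` is a greatest common left-divisor of `u` and `v` in `B_n⁺`. -/
def IsGCD (n : ℕ) (u v d : BraidGroup n) : Prop :=
  d ∈ PosBraid n ∧ PrefixLE n d u ∧ PrefixLE n d v ∧
    ∀ c ∈ PosBraid n, PrefixLE n c u → PrefixLE n c v → PrefixLE n c d

/-- `m` is a least common left-multiple of `u` and `v` in `B_n⁺`. -/
def IsLCM (n : ℕ) (u v m : BraidGroup n) : Prop :=
  m ∈ PosBraid n ∧ PrefixLE n u m ∧ PrefixLE n v m ∧
    ∀ c ∈ PosBraid n, PrefixLE n u c → PrefixLE n v c → PrefixLE n m c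

/-- Equivalence of positive words under the relations of the small-type Artin monoid of `G`. -/
inductive ArtinRel {I : Type*} (G : SimpleGraph I) : List I → List I → Prop
  | refl (u : List I) : ArtinRel G u u
  | symm {u v : List I} : ArtinRel G u v → ArtinRel G v u
  | trans {u v w : List I} : ArtinRel G u v → ArtinRel G v w → ArtinRel G u w
  | cons (i : I) {u v : List I} : ArtinRel G u v → ArtinRel G (i :: u) (i :: v)
  | comm {i j : I} (w : List I) : ¬ G.Adj i j → ArtinRel G (i :: j :: w) (j :: i :: w)
  | braid {i j : I} (w : List I) : G.Adj i j →
      ArtinRel G (i :: j :: i :: w) (j :: i :: j :: w)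

namespace ArtinRel

variable {I : Type*} {G : SimpleGraph I}

theorem length_eq {u v : List I} (h : ArtinRel G u v) : u.length = v.length := by
  induction h <;> simp_all

theorem append_right {u v : List I} (h : ArtinRel G u v) (w : List I) :
    ArtinRel G (u ++ w) (v ++ w) := by
  induction h with
  | refl u => exact refl _
  | symm _ ih => exact ih.symm
  | trans _ _ ih₁ ih₂ => exact ih₁.trans ih₂
  | cons i _ ih => exact ih.cons i
  | comm _ h => exact comm _ h
  | braid _ h => exact braid _ h

theorem append_left {u v : List I} (h : ArtinRel G u v) (w : List I) :
    ArtinRel G (w ++ u) (w ++ v) := by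
  induction w with
  | nil => exact h
  | cons i w ih => exact ih.cons i

theorem reverse {u v : List I} (h : ArtinRel G u v) : ArtinRel G u.reverse v.reverse := by
  induction h with
  | refl u => exact refl _
  | symm _ ih => exact ih.symm
  | trans _ _ ih₁ ih₂ => exact ih₁.trans ih₂
  | cons i _ ih => simpa using ih.append_right [i]
  | @comm i j w h =>
    simpa using (comm (G := G) [] (fun h' => h h'.symm) : ArtinRel G [j, i] [i, j]).append_left
      w.reverse
  | @braid i j w h =>
    simpa using (braid (G := G) [] h : ArtinRel G [i, j, i] [j, i, j]).append_left w.reverse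

end ArtinRel

/-- The congruence on the free monoid defining the small-type Artin monoid of `G`. -/
def artinCon {I : Type*} (G : SimpleGraph I) : Con (FreeMonoid I) where
  r := ArtinRel G
  iseqv := ⟨ArtinRel.refl, ArtinRel.symm, ArtinRel.trans⟩
  mul' := fun h₁ h₂ => (h₁.append_right _).trans (h₂.append_left _)

/-- The Artin monoid of small type attached to the graph `G`. -/
abbrev ArtinMonoid {I : Type*} (G : SimpleGraph I) := (artinCon G).Quotient

namespace ArtinMonoid

variable {I : Type*} {G : SimpleGraph I}

/-- The element represented by a word. -/
def ofWord (G : SimpleGraph I) (u : List I) : ArtinMonoid G :=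
  ((FreeMonoid.ofList u : FreeMonoid I) : (artinCon G).Quotient)

/-- The generators of the Artin monoid. -/
def gen (G : SimpleGraph I) (i : I) : ArtinMonoid G := ofWord G [i]

theorem ofWord_eq_iff {u v : List I} : ofWord G u = ofWord G v ↔ ArtinRel G u v :=
  (artinCon G).eq

theorem ofWord_surjective : Function.Surjective (ofWord G) := Quotient.mk''_surjective

@[simp] theorem ofWord_nil : ofWord G [] = 1 := rfl

theorem ofWord_append (u v : List I) : ofWord G (u ++ v) = ofWord G u * ofWord G v := rfl

theorem ofWord_cons (i : I) (u : List I) : ofWord G (i :: u) = gen G i * ofWord G u := rfl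

theorem gen_comm {i j : I} (h : ¬ G.Adj i j) (x : ArtinMonoid G) :
    gen G i * (gen G j * x) = gen G j * (gen G i * x) := by
  obtain ⟨w, rfl⟩ := ofWord_surjective x
  simp only [← ofWord_cons]
  exact ofWord_eq_iff.2 (.comm w h)

theorem gen_braid {i j : I} (h : G.Adj i j) (x : ArtinMonoid G) :
    gen G i * (gen G j * (gen G i * x)) = gen G j * (gen G i * (gen G j * x)) := by
  obtain ⟨w, rfl⟩ := ofWord_surjective x
  simp only [← ofWord_cons]
  exact ofWord_eq_iff.2 (.braid w h)

/-- The word length of an element of the Artin monoid. -/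
def len (x : ArtinMonoid G) : ℕ :=
  Quotient.lift (s := (artinCon G).toSetoid) (fun u : FreeMonoid I => u.toList.length)
    (fun _ _ h => ArtinRel.length_eq h) x

@[simp] theorem len_ofWord (u : List I) : len (ofWord G u) = u.length := rfl

theorem len_mul (x y : ArtinMonoid G) : len (x * y) = len x + len y := by
  obtain ⟨u, rfl⟩ := ofWord_surjective x
  obtain ⟨v, rfl⟩ := ofWord_surjective y
  simp [← ofWord_append]

@[simp] theorem len_one : len (1 : ArtinMonoid G) = 0 := rfl

@[simp] theorem len_gen (i : I) : len (gen G i) = 1 := rfl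

theorem eq_one_of_len {x : ArtinMonoid G} (h : len x = 0) : x = 1 := by
  obtain ⟨u, rfl⟩ := ofWord_surjective x
  simp at h
  simp [h]

theorem eq_one_or (x : ArtinMonoid G) : x = 1 ∨ ∃ i y, x = gen G i * y := by
  obtain ⟨u, rfl⟩ := ofWord_surjective x
  cases u with
  | nil => exact .inl rfl
  | cons i u => exact .inr ⟨i, ofWord G u, rfl⟩

/-- The conclusion of Garside's theorem about an equality `gen i * x = gen k * y`. -/
def HeadEq (i k : I) (x y : ArtinMonoid G) : Prop :=
  (i = k ∧ x = y) ∨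
  (i ≠ k ∧ ¬ G.Adj i k ∧ ∃ z, x = gen G k * z ∧ y = gen G i * z) ∨
  (G.Adj i k ∧ ∃ z, x = gen G k * (gen G i * z) ∧ y = gen G i * (gen G k * z))

theorem HeadEq.symm {i k : I} {x y : ArtinMonoid G} (h : HeadEq i k x y) : HeadEq k i y x := by
  rcases h with ⟨h, h'⟩ | ⟨h₁, h₂, z, hx, hy⟩ | ⟨h, z, hx, hy⟩
  · exact .inl ⟨h.symm, h'.symm⟩
  · exact .inr (.inl ⟨h₁.symm, fun h => h₂ h.symm, z, hy, hx⟩)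
  · exact .inr (.inr ⟨h.symm, z, hy, hx⟩)

theorem HeadEq.eq {i : I} {x y : ArtinMonoid G} (h : HeadEq i i x y) : x = y := by
  rcases h with h | h | h
  · exact h.2
  · exact absurd rfl h.1
  · exact absurd h.1 (G.loopless.irrefl i)

theorem HeadEq.of_not_adj {i k : I} {x y : ArtinMonoid G} (h : HeadEq i k x y) (hik : i ≠ k)
    (hadj : ¬ G.Adj i k) : ∃ z, x = gen G k * z ∧ y = gen G i * z := by
  rcases h with h | h | h
  · exact absurd h.1 hik
  · exact h.2.2
  · exact absurd h.1 hadj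

theorem HeadEq.of_adj {i k : I} {x y : ArtinMonoid G} (h : HeadEq i k x y)
    (hadj : G.Adj i k) : ∃ z, x = gen G k * (gen G i * z) ∧ y = gen G i * (gen G k * z) := by
  rcases h with h | h | h
  · exact absurd h.1 hadj.ne
  · exact absurd hadj h.2.1
  · exact h.2

/-- Transitivity of `HeadEq` across a letter `m` adjacent to `i` and commuting with `k`. -/
theorem HeadEq.trans_aux {N : ℕ}
    (ih : ∀ i k (x y : ArtinMonoid G), len x < N → gen G i * x = gen G k * y → HeadEq i k x y)
    {i m k : I} {x p q y : ArtinMonoid G} (hN : len x = N)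
    (him : G.Adj i m) (hmk : m ≠ k) (hmk' : ¬ G.Adj m k) (hik : i ≠ k)
    (hx : x = gen G m * (gen G i * p)) (hw : gen G i * (gen G m * p) = gen G k * q)
    (hy : y = gen G m * q) : HeadEq i k x y := by
  subst hx hy
  simp only [len_mul, len_gen] at hN
  by_cases hadj : G.Adj i k
  · obtain ⟨t, h₁, rfl⟩ := (ih _ _ _ _ (by simp only [len_mul, len_gen]; omega) hw).of_adj hadj
    have hl := congrArg len h₁
    simp only [len_mul, len_gen] at hl
    obtain ⟨u, rfl, h₂⟩ := (ih _ _ _ _ (by omega) h₁).of_not_adj hmk hmk'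
    simp only [len_mul, len_gen] at hl hN
    obtain ⟨v, rfl, rfl⟩ := (ih _ _ _ _ (by omega) h₂).of_adj him
    refine .inr (.inr ⟨hadj, gen G m * (gen G i * (gen G k * v)), ?_, ?_⟩)
    · rw [gen_braid hadj, gen_comm hmk', ← gen_comm hmk' v, gen_braid him.symm]
    · rw [← gen_comm hmk', gen_braid him.symm, gen_braid hadj, gen_comm hmk']
  · obtain ⟨z, h₁, rfl⟩ := (ih _ _ _ _ (by simp only [len_mul, len_gen]; omega) hw).of_not_adj
      hik hadj
    obtain ⟨t, rfl, rfl⟩ := (ih _ _ _ _ (by omega) h₁).of_not_adj hmk hmk'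
    refine .inr (.inl ⟨hik, hadj, gen G m * (gen G i * t), ?_, ?_⟩)
    · rw [gen_comm hadj, gen_comm hmk']
    · rw [gen_braid him]

theorem HeadEq.trans {N : ℕ} (hG : ∀ i j k, G.Adj i j → G.Adj j k → ¬ G.Adj i k)
    (ih : ∀ i k (x y : ArtinMonoid G), len x < N → gen G i * x = gen G k * y → HeadEq i k x y)
    {i m k : I} {x w y : ArtinMonoid G} (hN : len x = N) (hyN : len y = N)
    (h₁ : HeadEq i m x w) (h₂ : HeadEq m k w y) : HeadEq i k x y := by
  rcases h₁ with ⟨rfl, rfl⟩ | ⟨him, him', p, hx, hw⟩ | ⟨him, p, hx, hw⟩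
  · exact h₂
  · rcases h₂ with ⟨rfl, rfl⟩ | ⟨hmk, hmk', q, hw', hy⟩ | ⟨hmk, q, hw', hy⟩
    · exact .inr (.inl ⟨him, him', p, hx, hw⟩)
    · have hpq := hw.symm.trans hw'
      have hp : len p < N := by rw [← hN, hx, len_mul, len_gen]; omega
      subst hx hy
      rcases ih _ _ _ _ hp hpq with ⟨rfl, rfl⟩ | ⟨hik, hik', z, rfl, rfl⟩ | ⟨hik, z, rfl, rfl⟩
      · exact .inl ⟨rfl, rfl⟩
      · exact .inr (.inl ⟨hik, hik', gen G m * z, gen_comm hmk' _,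
          (gen_comm him' _).symm⟩)
      · refine .inr (.inr ⟨hik, gen G m * z, ?_, ?_⟩)
        · rw [gen_comm hmk', gen_comm him']
        · rw [← gen_comm him', gen_comm hmk']
    · have hik : i ≠ k := by rintro rfl; exact him' hmk.symm
      exact (HeadEq.trans_aux ih hyN hmk.symm him.symm (fun h => him' h.symm) hik.symm hy
        (hw'.symm.trans hw) hx).symm
  · rcases h₂ with ⟨rfl, rfl⟩ | ⟨hmk, hmk', q, hw', hy⟩ | ⟨hmk, q, hw', hy⟩
    · exact .inr (.inr ⟨him, p, hx, hw⟩)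
    · have hik : i ≠ k := by rintro rfl; exact hmk' him.symm
      exact HeadEq.trans_aux ih hN him hmk hmk' hik hx (hw.symm.trans hw') hy
    · have h := hw.symm.trans hw'
      subst hx hy
      simp only [len_mul, len_gen] at hN hyN
      have h' := ih _ _ _ _ (by simp only [len_mul, len_gen]; omega) h
      by_cases hik : i = k
      · subst hik
        have := (ih _ _ _ _ (by omega) h'.eq).eq
        exact .inl ⟨rfl, by rw [this]⟩
      have hik' := hG _ _ _ him hmk
      obtain ⟨t, h₃, h₄⟩ := h'.of_not_adj hik hik'
      obtain ⟨u, rfl, rfl⟩ := (ih _ _ _ _ (by omega) h₃).of_adj hmk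
      obtain ⟨v, rfl, h₅⟩ := (ih _ _ _ _ (by omega) h₄).of_adj him.symm
      simp only [len_mul, len_gen] at hN hyN
      have h₆ := (ih _ _ _ _ (by simp only [len_mul, len_gen]; omega) h₅).eq
      obtain ⟨s, rfl, rfl⟩ := (ih _ _ _ _ (by omega) h₆).of_not_adj (Ne.symm hik)
        (fun h => hik' h.symm)
      refine .inr (.inl ⟨hik, hik', gen G m * (gen G k * (gen G i * (gen G m * s))), ?_, ?_⟩)
      · rw [gen_comm hik', gen_braid him, gen_braid hmk]
      · rw [← gen_comm hik', ← gen_comm hik', gen_braid hmk.symm, gen_braid him.symm]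

theorem headEq_of_eq (hG : ∀ i j k, G.Adj i j → G.Adj j k → ¬ G.Adj i k) {i k : I}
    {x y : ArtinMonoid G} (h : gen G i * x = gen G k * y) : HeadEq i k x y := by
  induction hN : len x using Nat.strong_induction_on generalizing i k x y with
  | _ N ih =>
  subst hN
  have ih' : ∀ i k (x' y : ArtinMonoid G), len x' < len x → gen G i * x' = gen G k * y →
      HeadEq i k x' y := fun i k x' y hx h => ih _ hx h rfl
  clear ih
  obtain ⟨u, rfl⟩ := ofWord_surjective x
  obtain ⟨v, rfl⟩ := ofWord_surjective y
  simp only [← ofWord_cons, ofWord_eq_iff] at h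
  have key : ∀ a b, ArtinRel G a b → ∀ i k X Y, a = i :: X → b = k :: Y →
      X.length = u.length → HeadEq i k (ofWord G X) (ofWord G Y) := by
    intro a b hab
    induction hab with
    | refl a => rintro i k X Y rfl hb -; cases hb; exact .inl ⟨rfl, rfl⟩
    | symm hab ih =>
      rintro i k X Y rfl rfl hl
      have := hab.length_eq
      simp only [List.length_cons] at this
      exact (ih _ _ _ _ rfl rfl (by omega)).symm
    | @trans a w b h₁ h₂ ih₁ ih₂ =>
      rintro i k X Y rfl rfl hl
      have e₁ := h₁.length_eq
      have e₂ := h₂.length_eq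
      cases w with
      | nil => simp at e₁
      | cons m W =>
        simp only [List.length_cons] at e₁ e₂
        exact HeadEq.trans hG ih' (by simpa using hl) (by simp; omega)
          (ih₁ _ _ _ _ rfl rfl hl) (ih₂ _ _ _ _ rfl rfl (by omega))
    | cons i h _ =>
      rintro _ _ X Y ha hb -
      cases ha; cases hb
      exact .inl ⟨rfl, ofWord_eq_iff.2 h⟩
    | @comm i j w h =>
      rintro _ _ X Y ha hb -
      cases ha; cases hb
      by_cases hij : i = j
      · subst hij; exact .inl ⟨rfl, rfl⟩
      · exact .inr (.inl ⟨hij, h, ofWord G w, rfl, rfl⟩)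
    | @braid i j w h =>
      rintro _ _ X Y ha hb -
      cases ha; cases hb
      exact .inr (.inr ⟨h, ofWord G w, rfl, rfl⟩)
  exact key _ _ h i k u v rfl rfl rfl

theorem mul_left_cancel' (hG : ∀ i j k, G.Adj i j → G.Adj j k → ¬ G.Adj i k)
    (a : ArtinMonoid G) {x y : ArtinMonoid G} (h : a * x = a * y) : x = y := by
  obtain ⟨u, rfl⟩ := ofWord_surjective a
  induction u with
  | nil => simpa using h
  | cons i u ih =>
    rw [ofWord_cons, mul_assoc, mul_assoc] at h
    exact ih (headEq_of_eq hG h).eq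

theorem mul_right_cancel' (hG : ∀ i j k, G.Adj i j → G.Adj j k → ¬ G.Adj i k)
    (a : ArtinMonoid G) {x y : ArtinMonoid G} (h : x * a = y * a) : x = y := by
  obtain ⟨u, rfl⟩ := ofWord_surjective a
  obtain ⟨v, rfl⟩ := ofWord_surjective x
  obtain ⟨w, rfl⟩ := ofWord_surjective y
  rw [← ofWord_append, ← ofWord_append, ofWord_eq_iff] at h
  have h' := h.reverse
  rw [List.reverse_append, List.reverse_append, ← ofWord_eq_iff, ofWord_append,
    ofWord_append] at h'
  exact ofWord_eq_iff.2 (by simpa using (ofWord_eq_iff.1 (mul_left_cancel' hG _ h')).reverse)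

theorem len_le_of_dvd {x y : ArtinMonoid G} (h : x ∣ y) : len x ≤ len y := by
  obtain ⟨z, rfl⟩ := h
  rw [len_mul]
  omega

theorem dvd_of_mul_dvd_mul (hG : ∀ i j k, G.Adj i j → G.Adj j k → ¬ G.Adj i k)
    {a x y : ArtinMonoid G} (h : a * x ∣ a * y) : x ∣ y := by
  obtain ⟨z, hz⟩ := h
  rw [mul_assoc] at hz
  exact ⟨z, mul_left_cancel' hG a hz⟩

/-- Two generators with a common right multiple have a least one. -/
theorem exists_gen_lcm (hG : ∀ i j k, G.Adj i j → G.Adj j k → ¬ G.Adj i k) {i j : I}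
    {x y : ArtinMonoid G} (h : gen G i * x = gen G j * y) :
    ∃ c d : ArtinMonoid G, gen G i * c = gen G j * d ∧ c ∣ x ∧ d ∣ y ∧
      ∀ m, gen G i ∣ m → gen G j ∣ m → gen G i * c ∣ m := by
  rcases headEq_of_eq hG h with ⟨rfl, rfl⟩ | ⟨hij, hadj, z, rfl, rfl⟩ | ⟨hadj, z, rfl, rfl⟩
  · exact ⟨1, 1, rfl, one_dvd _, one_dvd _, fun m hm _ => by simpa using hm⟩
  · refine ⟨gen G j, gen G i, by simpa using gen_comm hadj 1, ⟨z, rfl⟩, ⟨z, rfl⟩, ?_⟩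
    rintro m ⟨p, rfl⟩ ⟨q, hq⟩
    obtain ⟨t, rfl, -⟩ := (headEq_of_eq hG hq).of_not_adj hij hadj
    exact ⟨t, (mul_assoc _ _ _).symm⟩
  · refine ⟨gen G j * gen G i, gen G i * gen G j, by simpa using gen_braid hadj 1,
      ⟨z, (mul_assoc _ _ _).symm⟩, ⟨z, (mul_assoc _ _ _).symm⟩, ?_⟩
    rintro m ⟨p, rfl⟩ ⟨q, hq⟩
    obtain ⟨t, rfl, -⟩ := (headEq_of_eq hG hq).of_adj hadj
    exact ⟨t, by simp only [mul_assoc]⟩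

/-- Elements with a common right multiple have a least common right multiple. -/
theorem exists_lcm (hG : ∀ i j k, G.Adj i j → G.Adj j k → ¬ G.Adj i k)
    {a b m : ArtinMonoid G} (ha : a ∣ m) (hb : b ∣ m) :
    ∃ l, a ∣ l ∧ b ∣ l ∧ ∀ c, a ∣ c → b ∣ c → l ∣ c := by
  induction hN : len m using Nat.strong_induction_on generalizing a b m with
  | _ N ih =>
  subst hN
  rcases eq_one_or a with rfl | ⟨i, a, rfl⟩
  · exact ⟨b, one_dvd _, dvd_rfl, fun _ _ h => h⟩
  rcases eq_one_or b with rfl | ⟨j, b, rfl⟩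
  · exact ⟨_, dvd_rfl, one_dvd _, fun _ h _ => h⟩
  obtain ⟨x, rfl⟩ := ha
  obtain ⟨y, hy⟩ := hb
  rw [mul_assoc, mul_assoc] at hy
  obtain ⟨c, d, hcd, ⟨z, hz⟩, ⟨z', hz'⟩, hmin⟩ := exists_gen_lcm hG hy
  have hzz : z = z' := by
    apply mul_left_cancel' hG (gen G i * c)
    rw [mul_assoc, ← hz, hy, hz', ← mul_assoc, ← hcd]
  subst hzz
  have hlen : len (gen G i * a * x) = len (gen G j * (b * y)) := by rw [← hy, mul_assoc]
  obtain ⟨e₁, hae, ⟨f₁, rfl⟩, hmin₁⟩ := ih (len (a * x))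
    (by simp only [len_mul, len_gen]; omega) (Dvd.intro x rfl) (Dvd.intro z hz.symm) rfl
  obtain ⟨e₂, hbe, ⟨f₂, rfl⟩, hmin₂⟩ := ih (len (b * y))
    (by rw [hlen, len_mul (gen G j), len_gen]; omega) (Dvd.intro y rfl) (Dvd.intro z hz'.symm) rfl
  have hf₁ : f₁ ∣ z := by
    apply dvd_of_mul_dvd_mul hG (a := c)
    rw [← hz]
    exact hmin₁ _ (Dvd.intro x rfl) (Dvd.intro z hz.symm)
  have hf₂ : f₂ ∣ z := by
    apply dvd_of_mul_dvd_mul hG (a := d)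
    rw [← hz']
    exact hmin₂ _ (Dvd.intro y rfl) (Dvd.intro z hz'.symm)
  have hlz : len z < len (gen G i * a * x) := by
    rw [mul_assoc, hz]
    simp only [len_mul, len_gen]
    omega
  obtain ⟨f, hf₁f, hf₂f, hmin₃⟩ := ih (len z) hlz hf₁ hf₂ rfl
  refine ⟨gen G i * c * f, ?_, ?_, ?_⟩
  · rw [mul_assoc]
    exact mul_dvd_mul_left _ (hae.trans (mul_dvd_mul_left _ hf₁f))
  · rw [hcd, mul_assoc]
    exact mul_dvd_mul_left _ (hbe.trans (mul_dvd_mul_left _ hf₂f))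
  · intro m hm₁ hm₂
    obtain ⟨t, rfl⟩ := hmin m (dvd_of_mul_right_dvd hm₁) (dvd_of_mul_right_dvd hm₂)
    refine mul_dvd_mul_left _ (hmin₃ t ?_ ?_)
    · rw [mul_assoc] at hm₁
      exact dvd_of_mul_dvd_mul hG
        (hmin₁ _ (dvd_of_mul_dvd_mul hG hm₁) (Dvd.intro t rfl))
    · rw [hcd, mul_assoc] at hm₂
      exact dvd_of_mul_dvd_mul hG
        (hmin₂ _ (dvd_of_mul_dvd_mul hG hm₂) (Dvd.intro t rfl))

/-- Any two elements have a greatest common left divisor. -/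
theorem exists_gcd (hG : ∀ i j k, G.Adj i j → G.Adj j k → ¬ G.Adj i k) (a b : ArtinMonoid G) :
    ∃ d, d ∣ a ∧ d ∣ b ∧ ∀ c, c ∣ a → c ∣ b → c ∣ d := by
  classical
  let P : ℕ → Prop := fun k => ∃ d : ArtinMonoid G, d ∣ a ∧ d ∣ b ∧ len d = k
  obtain ⟨d, hda, hdb, hd⟩ : P (Nat.findGreatest P (len a)) :=
    Nat.findGreatest_spec (m := 0) (Nat.zero_le _) ⟨1, one_dvd _, one_dvd _, rfl⟩
  refine ⟨d, hda, hdb, fun c hca hcb => ?_⟩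
  obtain ⟨l, hdl, hcl, hmin⟩ := exists_lcm hG hda hca
  have hla := hmin a hda hca
  have hle : len l ≤ len d := by
    rw [hd]
    exact Nat.le_findGreatest (len_le_of_dvd hla) ⟨l, hla, hmin b hdb hcb, rfl⟩
  obtain ⟨e, rfl⟩ := hdl
  have he : e = 1 := eq_one_of_len (by rw [len_mul] at hle; omega)
  simpa [he] using hcl

end ArtinMonoid

/-- A cancellative monoid in which every element right-divides a central one embeds in a group. -/
theorem exists_injective_unitsHom.{u} {M : Type u} [Monoid M]
    (hl : ∀ a x y : M, a * x = a * y → x = y) (hr : ∀ a x y : M, x * a = y * a → x = y)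
    (hc : ∀ a : M, ∃ b, ∀ x, (b * a) * x = x * (b * a)) :
    ∃ (N : Type u) (_ : Monoid N) (f : M →* Nˣ), Function.Injective f := by
  choose b hb using hc
  let _ : OreLocalization.OreSet (⊤ : Submonoid M) :=
    { ore_right_cancel := fun r₁ r₂ s h => ⟨1, by rw [hr _ _ _ h]⟩
      oreNum := fun r s => r * b s
      oreDenom := fun r s => ⟨b s * s, trivial⟩
      ore_eq := fun r s => by simp only [hb, mul_assoc] }
  refine ⟨OreLocalization (⊤ : Submonoid M) M, inferInstance,
    Units.liftRight OreLocalization.numeratorHom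
      (fun x => OreLocalization.numeratorUnit (⟨x, Submonoid.mem_top x⟩ : (⊤ : Submonoid M)))
      (fun x => rfl), ?_⟩
  intro x y hxy
  have h : (x /ₒ (1 : (⊤ : Submonoid M)) : OreLocalization (⊤ : Submonoid M) M) = y /ₒ 1 :=
    congrArg Units.val hxy
  rw [OreLocalization.oreDiv_eq_iff] at h
  obtain ⟨u, v, h₁, h₂⟩ := h
  simp only [Submonoid.smul_def, smul_eq_mul, Submonoid.coe_one, mul_one] at h₁ h₂
  rw [h₂] at h₁
  exact (hl _ _ _ h₁).symm

section HalfTwist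

variable {M : Type*} [Monoid M]

/-- The descending product `s (k - 1) * ⋯ * s 0`. -/
def descProd (s : ℕ → M) : ℕ → M
  | 0 => 1
  | k + 1 => s k * descProd s k

/-- The half-twist on the first `k` generators. -/
def halfTwist (s : ℕ → M) : ℕ → M
  | 0 => 1
  | k + 1 => halfTwist s k * descProd s (k + 1)

/-- The braid relations for the first `N` terms of a sequence. -/
structure SatisfiesBraid (s : ℕ → M) (N : ℕ) : Prop where
  comm : ∀ i j, i + 1 < j → j < N → s i * s j = s j * s i
  braid : ∀ i, i + 1 < N → s i * s (i + 1) * s i = s (i + 1) * s i * s (i + 1)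

variable {s : ℕ → M} {N : ℕ}

theorem SatisfiesBraid.commute_descProd (h : SatisfiesBraid s N) {j k : ℕ} (hk : k < j)
    (hj : j < N) : Commute (s j) (descProd s k) := by
  induction k with
  | zero => exact Commute.one_right _
  | succ k ih => exact Commute.mul_right (h.comm k j hk hj).symm (ih (by omega))

theorem SatisfiesBraid.commute_halfTwist (h : SatisfiesBraid s N) {j k : ℕ} (hk : k < j)
    (hj : j < N) : Commute (s j) (halfTwist s k) := by
  induction k with
  | zero => exact Commute.one_right _
  | succ k ih => exact Commute.mul_right (ih (by omega)) (h.commute_descProd hk hj)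

theorem SatisfiesBraid.mul_descProd (h : SatisfiesBraid s N) {i k : ℕ} (hi : i + 1 < k)
    (hk : k ≤ N) : s i * descProd s k = descProd s k * s (i + 1) := by
  induction k with
  | zero => omega
  | succ k ih =>
    rcases Nat.lt_or_ge (i + 1) k with hik | hik
    · rw [descProd, ← mul_assoc, h.comm i k hik hk, mul_assoc, ih hik (by omega), mul_assoc]
    · obtain rfl : k = i + 1 := by omega
      have hc : Commute (s (i + 1)) (descProd s i) := h.commute_descProd (by omega) hk
      simp only [descProd]
      rw [mul_assoc, mul_assoc, ← hc.eq, ← mul_assoc, ← mul_assoc, h.braid i hk]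
      simp only [mul_assoc]

theorem descProd_succ_eq (s : ℕ → M) (k : ℕ) :
    descProd s (k + 1) = descProd (fun i => s (i + 1)) k * s 0 := by
  induction k with
  | zero => simp [descProd]
  | succ k ih => rw [descProd, ih, descProd, mul_assoc]

theorem SatisfiesBraid.descProd_mul_descProd (h : SatisfiesBraid s N) {j k : ℕ} (hj : j < k)
    (hk : k ≤ N) :
    descProd s j * descProd s k = descProd s k * descProd (fun i => s (i + 1)) j := by
  induction j with
  | zero => simp [descProd]
  | succ j ih =>
    rw [descProd, mul_assoc, ih (by omega), ← mul_assoc, h.mul_descProd hj hk, mul_assoc, descProd]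

/-- Conjugation by the half-twist reverses the order of the generators. -/
theorem SatisfiesBraid.mul_halfTwist (h : SatisfiesBraid s N) {i k : ℕ} (hi : i < k)
    (hk : k ≤ N) : s i * halfTwist s k = halfTwist s k * s (k - 1 - i) := by
  induction k with
  | zero => omega
  | succ k ih =>
    rcases Nat.lt_or_ge i k with hik | hik
    · rw [halfTwist, ← mul_assoc, ih hik (by omega), mul_assoc,
        h.mul_descProd (by omega) hk, show k - 1 - i + 1 = k + 1 - 1 - i by omega, mul_assoc]
    · obtain rfl : i = k := by omega
      rw [show i + 1 - 1 - i = 0 by omega]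
      cases i with
      | zero => simp [halfTwist, descProd]
      | succ k =>
        have hc : Commute (s (k + 1)) (halfTwist s k) := h.commute_halfTwist (by omega) hk
        have hd : s (k + 1) * descProd s (k + 1) = descProd s (k + 2) := rfl
        simp only [halfTwist]
        rw [← mul_assoc, ← mul_assoc, hc.eq, mul_assoc, mul_assoc, ← mul_assoc (s (k + 1)), hd,
          mul_assoc, mul_assoc, ← mul_assoc (descProd s (k + 1)),
          h.descProd_mul_descProd (Nat.lt_succ_self (k + 1)) hk, mul_assoc, ← descProd_succ_eq]

/-- Every generator right-divides the half-twist. -/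
theorem SatisfiesBraid.exists_halfTwist_eq_mul (h : SatisfiesBraid s N) {j k : ℕ} (hj : j < k)
    (hk : k ≤ N) : ∃ e, halfTwist s k = e * s j := by
  induction k generalizing j with
  | zero => omega
  | succ k ih =>
    cases j with
    | zero => exact ⟨_, by rw [halfTwist, descProd_succ_eq, ← mul_assoc]⟩
    | succ j =>
      obtain ⟨e, he⟩ := ih (j := j) (by omega) (by omega)
      exact ⟨e * descProd s (k + 1), by
        rw [halfTwist, he, mul_assoc, h.mul_descProd (by omega) hk, mul_assoc]⟩

theorem map_descProd {M' : Type*} [Monoid M'] (f : M →* M') (s : ℕ → M) (k : ℕ) :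
    f (descProd s k) = descProd (fun i => f (s i)) k := by
  induction k with
  | zero => exact map_one f
  | succ k ih => rw [descProd, map_mul, ih, descProd]

theorem map_halfTwist {M' : Type*} [Monoid M'] (f : M →* M') (s : ℕ → M) (k : ℕ) :
    f (halfTwist s k) = halfTwist (fun i => f (s i)) k := by
  induction k with
  | zero => exact map_one f
  | succ k ih => rw [halfTwist, map_mul, ih, map_descProd, halfTwist]

theorem descProd_eq_prod (s : ℕ → M) (k : ℕ) :
    descProd s k = ((List.range k).reverse.map s).prod := by
  induction k with
  | zero => rfl
  | succ k ih => simp [descProd, ih, List.range_succ]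

theorem halfTwist_eq_prod (s : ℕ → M) (k : ℕ) :
    halfTwist s k = ((List.range k).map fun i => descProd s (i + 1)).prod := by
  induction k with
  | zero => rfl
  | succ k ih => simp [halfTwist, ih, List.range_succ]

end HalfTwist

section BraidMonoid

open ArtinMonoid

theorem pathGraph_adj_adj {m : ℕ} (i j k : Fin m) (hij : (SimpleGraph.pathGraph m).Adj i j)
    (hjk : (SimpleGraph.pathGraph m).Adj j k) : ¬ (SimpleGraph.pathGraph m).Adj i k := by
  rw [SimpleGraph.pathGraph_adj] at *
  omega

/-- The abstract monoid of positive braids. -/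
abbrev BraidMonoid (n : ℕ) := ArtinMonoid (SimpleGraph.pathGraph (n - 1))

theorem braidGen_comm {n : ℕ} {i j : Fin (n - 1)} (h : ¬ (SimpleGraph.pathGraph (n - 1)).Adj i j) :
    braidGen n i * braidGen n j = braidGen n j * braidGen n i := by
  have key : ∀ i j : Fin (n - 1), (i : ℕ) + 1 < j →
      braidGen n i * braidGen n j = braidGen n j * braidGen n i := fun i j hij =>
    mul_inv_eq_one.1 (PresentedGroup.one_of_mem (rels := braidRels n) (.inr ⟨i, j, hij, rfl⟩))
  rw [SimpleGraph.pathGraph_adj] at h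
  rcases lt_trichotomy (i : ℕ) j with hij | hij | hij
  · exact key i j (by omega)
  · rw [Fin.ext hij]
  · exact (key j i (by omega)).symm

theorem braidGen_braid {n : ℕ} {i j : Fin (n - 1)} (h : (SimpleGraph.pathGraph (n - 1)).Adj i j) :
    braidGen n i * braidGen n j * braidGen n i = braidGen n j * braidGen n i * braidGen n j := by
  have key : ∀ i j : Fin (n - 1), (i : ℕ) + 1 = j → braidGen n i * braidGen n j * braidGen n i =
      braidGen n j * braidGen n i * braidGen n j := fun i j hij =>
    mul_inv_eq_one.1 (PresentedGroup.one_of_mem (rels := braidRels n) (.inl ⟨i, j, hij, rfl⟩))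
  rcases SimpleGraph.pathGraph_adj.1 h with hij | hij
  · exact key i j hij
  · exact (key j i hij).symm

/-- The canonical homomorphism from the braid monoid to the braid group. -/
def toBraid (n : ℕ) : BraidMonoid n →* BraidGroup n :=
  (artinCon (SimpleGraph.pathGraph (n - 1))).lift (FreeMonoid.lift (braidGen n)) (by
    intro u v h
    change ArtinRel _ u v at h
    change FreeMonoid.lift (braidGen n) u = FreeMonoid.lift (braidGen n) v
    have key : ∀ (i : Fin (n - 1)) (u : List (Fin (n - 1))),
        FreeMonoid.lift (braidGen n) (FreeMonoid.ofList (i :: u)) =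
          braidGen n i * FreeMonoid.lift (braidGen n) (FreeMonoid.ofList u) := fun i u => by
      rw [FreeMonoid.ofList_cons, map_mul, FreeMonoid.lift_eval_of]
    induction h with
    | refl u => rfl
    | symm _ ih => exact ih.symm
    | trans _ _ ih₁ ih₂ => exact ih₁.trans ih₂
    | cons i _ ih => exact (key i _).trans ((congrArg _ ih).trans (key i _).symm)
    | @comm i j w h =>
      refine (key _ _).trans (Eq.trans ?_ (key _ _).symm)
      rw [key, key, ← mul_assoc, ← mul_assoc, braidGen_comm h]
    | @braid i j w h =>
      refine (key _ _).trans (Eq.trans ?_ (key _ _).symm)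
      rw [key, key, key, key, ← mul_assoc, ← mul_assoc, ← mul_assoc, ← mul_assoc,
        braidGen_braid h])

@[simp] theorem toBraid_gen (n : ℕ) (i : Fin (n - 1)) :
    toBraid n (gen _ i) = braidGen n i :=
  FreeMonoid.lift_eval_of _ _

/-- The generators of the braid monoid as a sequence, extended by `1`. -/
def genSeq (n i : ℕ) : BraidMonoid n := if h : i < n - 1 then gen _ ⟨i, h⟩ else 1

theorem genSeq_coe {n : ℕ} (i : Fin (n - 1)) : genSeq n i = gen _ i := dif_pos i.2

theorem satisfiesBraid_genSeq (n : ℕ) : SatisfiesBraid (genSeq n) (n - 1) where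
  comm i j hij hj := by
    have h : ¬ (SimpleGraph.pathGraph (n - 1)).Adj ⟨i, by omega⟩ ⟨j, hj⟩ := by
      rw [SimpleGraph.pathGraph_adj]; simp only; omega
    simpa [genSeq, hj, show i < n - 1 by omega] using gen_comm h 1
  braid i hi := by
    have h : (SimpleGraph.pathGraph (n - 1)).Adj ⟨i, by omega⟩ ⟨i + 1, hi⟩ := by
      rw [SimpleGraph.pathGraph_adj]; simp
    simpa [genSeq, hi, show i < n - 1 by omega, mul_assoc] using gen_braid h 1

/-- The half-twist in the braid monoid. -/
def monoidDelta (n : ℕ) : BraidMonoid n := halfTwist (genSeq n) (n - 1)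

theorem gen_mul_monoidDelta {n : ℕ} (i : Fin (n - 1)) :
    gen _ i * monoidDelta n = monoidDelta n * gen _ i.rev := by
  rw [← genSeq_coe, monoidDelta, (satisfiesBraid_genSeq n).mul_halfTwist i.2 le_rfl, ← genSeq_coe,
    Fin.val_rev, Nat.sub_add_eq, Nat.sub_right_comm]

theorem monoidDelta_sq_central {n : ℕ} (x : BraidMonoid n) :
    x * monoidDelta n ^ 2 = monoidDelta n ^ 2 * x := by
  obtain ⟨u, rfl⟩ := ofWord_surjective x
  induction u with
  | nil => simp
  | cons i u ih =>
    rw [ofWord_cons, mul_assoc, ih, pow_two, ← mul_assoc, ← mul_assoc, gen_mul_monoidDelta,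
      mul_assoc (monoidDelta n), gen_mul_monoidDelta, Fin.rev_rev]
    simp only [mul_assoc]

theorem exists_mul_gen_eq_monoidDelta {n : ℕ} (i : Fin (n - 1)) :
    ∃ e, monoidDelta n = e * gen _ i := by
  rw [← genSeq_coe]
  exact (satisfiesBraid_genSeq n).exists_halfTwist_eq_mul i.2 le_rfl

theorem gen_dvd_monoidDelta {n : ℕ} (i : Fin (n - 1)) : gen _ i ∣ monoidDelta n := by
  obtain ⟨e, he⟩ := exists_mul_gen_eq_monoidDelta i.rev
  refine ⟨e, mul_right_cancel' pathGraph_adj_adj (gen _ i.rev) ?_⟩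
  rw [mul_assoc, ← he, gen_mul_monoidDelta]

theorem exists_mul_eq_monoidDelta_pow {n : ℕ} (x : BraidMonoid n) :
    ∃ (y : BraidMonoid n) (k : ℕ), y * x = (monoidDelta n ^ 2) ^ k := by
  obtain ⟨u, rfl⟩ := ofWord_surjective x
  induction u with
  | nil => exact ⟨1, 0, by simp⟩
  | cons i u ih =>
    obtain ⟨y, k, hy⟩ := ih
    obtain ⟨e, he⟩ := exists_mul_gen_eq_monoidDelta i
    refine ⟨y * (monoidDelta n * e), k + 1, ?_⟩
    rw [ofWord_cons, mul_assoc, mul_assoc, ← mul_assoc e, ← he, ← mul_assoc (monoidDelta n),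
      ← pow_two, ← monoidDelta_sq_central, ← mul_assoc, hy,
      pow_succ (monoidDelta n ^ 2)]

theorem toBraid_injective (n : ℕ) : Function.Injective (toBraid n) := by
  obtain ⟨N, _, f, hf⟩ := exists_injective_unitsHom (M := BraidMonoid n)
    (fun a x y => mul_left_cancel' pathGraph_adj_adj a)
    (fun a x y => mul_right_cancel' pathGraph_adj_adj a) (fun a => by
      obtain ⟨y, k, hy⟩ := exists_mul_eq_monoidDelta_pow a
      refine ⟨y, fun x => ?_⟩
      rw [hy]
      exact (Commute.pow_right (monoidDelta_sq_central x) k).symm.eq)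
  have hrel : ∀ w ∈ braidRels n,
      FreeGroup.lift (fun i => f (gen (SimpleGraph.pathGraph (n - 1)) i)) w = 1 := by
    rintro w (⟨i, j, hij, rfl⟩ | ⟨i, j, hij, rfl⟩)
    · have h := gen_braid (SimpleGraph.pathGraph_adj.2 (.inl hij)) 1
      simp only [map_mul, map_inv, FreeGroup.lift_apply_of, mul_inv_eq_one]
      simpa [mul_assoc] using congrArg f h
    · have hadj : ¬ (SimpleGraph.pathGraph (n - 1)).Adj i j := by
        rw [SimpleGraph.pathGraph_adj]; omega
      have h := gen_comm hadj 1
      simp only [map_mul, map_inv, FreeGroup.lift_apply_of, mul_inv_eq_one]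
      simpa using congrArg f h
  have hcomp : ∀ x, PresentedGroup.toGroup hrel (toBraid n x) = f x := by
    intro x
    obtain ⟨u, rfl⟩ := ofWord_surjective x
    induction u with
    | nil => simp
    | cons i u ih =>
      rw [ofWord_cons, map_mul, map_mul, ih, toBraid_gen, map_mul]
      exact congrArg (· * _) (PresentedGroup.toGroup.of hrel)
  intro x y hxy
  exact hf (by rw [← hcomp, ← hcomp, hxy])

theorem mem_posBraid_iff {n : ℕ} {b : BraidGroup n} : b ∈ PosBraid n ↔ ∃ x, toBraid n x = b := by
  constructor
  · intro h
    induction h using Submonoid.closure_induction with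
    | mem _ h =>
      obtain ⟨i, rfl⟩ := h
      exact ⟨_, toBraid_gen n i⟩
    | one => exact ⟨1, map_one _⟩
    | mul _ _ _ _ h₁ h₂ =>
      obtain ⟨x, rfl⟩ := h₁
      obtain ⟨y, rfl⟩ := h₂
      exact ⟨x * y, map_mul _ _ _⟩
  · rintro ⟨x, rfl⟩
    obtain ⟨u, rfl⟩ := ofWord_surjective x
    induction u with
    | nil => simp
    | cons i u ih =>
      rw [ofWord_cons, map_mul, toBraid_gen]
      exact mul_mem (Submonoid.subset_closure ⟨i, rfl⟩) ih

theorem prefixLE_toBraid_iff {n : ℕ} {x y : BraidMonoid n} :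
    PrefixLE n (toBraid n x) (toBraid n y) ↔ x ∣ y := by
  constructor
  · rintro ⟨c, hc, h⟩
    obtain ⟨z, rfl⟩ := mem_posBraid_iff.1 hc
    exact ⟨z, toBraid_injective n (by rw [map_mul, h])⟩
  · rintro ⟨z, rfl⟩
    exact ⟨toBraid n z, mem_posBraid_iff.2 ⟨z, rfl⟩, (map_mul _ _ _).symm⟩

theorem List.filter_le_range {k N : ℕ} (h : k < N) :
    (List.range N).filter (fun i => decide (i ≤ k)) = List.range (k + 1) := by
  induction N, h using Nat.le_induction with
  | base => exact List.filter_eq_self.2 fun i hi => by simpa [Nat.lt_succ_iff] using hi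
  | succ N hN ih => simp [List.range_succ (n := N), ih, show ¬ N ≤ k by omega]

theorem toBraid_monoidDelta (n : ℕ) : toBraid n (monoidDelta n) = braidDelta n := by
  rw [monoidDelta, map_halfTwist, halfTwist_eq_prod, braidDelta, ← List.map_coe_finRange_eq_range,
    List.map_map]
  congr 1
  refine List.map_congr_left fun k _ => ?_
  have hfilter : ((List.finRange (n - 1)).filter fun i => decide (i ≤ k)).map Fin.val =
      List.range (k + 1) := by
    rw [← List.filter_le_range k.2, ← List.map_coe_finRange_eq_range, List.filter_map]
    rfl
  rw [Function.comp_apply, descProd_eq_prod, ← hfilter, ← List.map_reverse, List.map_map]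
  congr 1
  refine List.map_congr_left fun i _ => ?_
  rw [Function.comp_apply, genSeq_coe, toBraid_gen]

end BraidMonoid

section BraidGroup

variable {n : ℕ}

theorem braidDelta_mem : braidDelta n ∈ PosBraid n :=
  mem_posBraid_iff.2 ⟨_, toBraid_monoidDelta n⟩

theorem prefixLE_iff {a b : BraidGroup n} : PrefixLE n a b ↔ a⁻¹ * b ∈ PosBraid n := by
  constructor
  · rintro ⟨c, hc, rfl⟩
    simpa using hc
  · exact fun h => ⟨_, h, by simp⟩

theorem PrefixLE.trans {a b c : BraidGroup n} (h₁ : PrefixLE n a b) (h₂ : PrefixLE n b c) :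
    PrefixLE n a c := by
  obtain ⟨x, hx, rfl⟩ := h₁
  obtain ⟨y, hy, rfl⟩ := h₂
  exact ⟨x * y, mul_mem hx hy, (mul_assoc _ _ _).symm⟩

theorem prefixLE_mul_left_iff {a b c : BraidGroup n} :
    PrefixLE n (c * a) (c * b) ↔ PrefixLE n a b := by
  rw [prefixLE_iff, prefixLE_iff, mul_inv_rev, mul_assoc, inv_mul_cancel_left]

/-- Positive braids have greatest common prefixes. -/
theorem exists_isGCD {u v : BraidGroup n} (hu : u ∈ PosBraid n) (hv : v ∈ PosBraid n) :
    ∃ d, IsGCD n u v d := by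
  obtain ⟨x, rfl⟩ := mem_posBraid_iff.1 hu
  obtain ⟨y, rfl⟩ := mem_posBraid_iff.1 hv
  obtain ⟨d, hdx, hdy, hd⟩ := ArtinMonoid.exists_gcd pathGraph_adj_adj x y
  refine ⟨toBraid n d, mem_posBraid_iff.2 ⟨d, rfl⟩, prefixLE_toBraid_iff.2 hdx,
    prefixLE_toBraid_iff.2 hdy, fun c hc hcx hcy => ?_⟩
  obtain ⟨c, rfl⟩ := mem_posBraid_iff.1 hc
  exact prefixLE_toBraid_iff.2 (hd c (prefixLE_toBraid_iff.1 hcx) (prefixLE_toBraid_iff.1 hcy))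

/-- Left multiplication by a positive braid preserves greatest common prefixes. -/
theorem IsGCD.prefixLE_mul {u v d p c : BraidGroup n} (h : IsGCD n u v d) (hu : u ∈ PosBraid n)
    (hv : v ∈ PosBraid n) (hp : p ∈ PosBraid n) (hc : c ∈ PosBraid n)
    (hcu : PrefixLE n c (p * u)) (hcv : PrefixLE n c (p * v)) : PrefixLE n c (p * d) := by
  obtain ⟨g, -, hgu, hgv, hg⟩ := exists_isGCD (mul_mem hp hu) (mul_mem hp hv)
  obtain ⟨e, he, rfl⟩ := hg p hp ⟨u, hu, rfl⟩ ⟨v, hv, rfl⟩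
  exact (hg c hc hcu hcv).trans (prefixLE_mul_left_iff.2
    (h.2.2.2 e he (prefixLE_mul_left_iff.1 hgu) (prefixLE_mul_left_iff.1 hgv)))

theorem braidGen_mul_braidDelta (i : Fin (n - 1)) :
    braidGen n i * braidDelta n = braidDelta n * braidGen n i.rev := by
  rw [← toBraid_monoidDelta, ← toBraid_gen, ← toBraid_gen, ← map_mul, gen_mul_monoidDelta, map_mul]

theorem braidGen_prefixLE_braidDelta (i : Fin (n - 1)) :
    PrefixLE n (braidGen n i) (braidDelta n) := by
  rw [← toBraid_monoidDelta, ← toBraid_gen, prefixLE_toBraid_iff]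
  exact gen_dvd_monoidDelta i

theorem braidDelta_inv_conj_mem {x : BraidGroup n} (hx : x ∈ PosBraid n) :
    (braidDelta n)⁻¹ * x * braidDelta n ∈ PosBraid n := by
  induction hx using Submonoid.closure_induction with
  | mem _ h =>
    obtain ⟨i, rfl⟩ := h
    rw [mul_assoc, braidGen_mul_braidDelta, inv_mul_cancel_left]
    exact Submonoid.subset_closure ⟨_, rfl⟩
  | one => simp
  | mul x y _ _ hx hy => simpa [mul_assoc] using mul_mem hx hy

theorem braidDelta_sq_commute (b : BraidGroup n) : Commute (braidDelta n ^ 2) b := by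
  have h := PresentedGroup.generated_by (braidRels n) (Subgroup.centralizer {braidDelta n ^ 2})
    (fun i => by
      rw [Subgroup.mem_centralizer_singleton_iff]
      change braidGen n i * _ = _ * braidGen n i
      rw [← toBraid_monoidDelta, ← toBraid_gen, ← map_pow, ← map_mul, ← map_mul,
        monoidDelta_sq_central]) b
  exact (Subgroup.mem_centralizer_singleton_iff.1 h).symm

theorem braidDelta_conj_mem {x : BraidGroup n} (hx : x ∈ PosBraid n) :
    braidDelta n * x * (braidDelta n)⁻¹ ∈ PosBraid n := by
  have h := braidDelta_inv_conj_mem hx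
  have hc := (braidDelta_sq_commute x).eq
  rwa [show (braidDelta n)⁻¹ * x * braidDelta n = braidDelta n * x * (braidDelta n)⁻¹ from ?_] at h
  rw [eq_mul_inv_iff_mul_eq, mul_assoc, ← pow_two, mul_assoc, ← hc, pow_two, ← mul_assoc,
    ← mul_assoc, inv_mul_cancel, one_mul]

/-- Conjugation by a power of the half-twist preserves positivity. -/
theorem braidDelta_zpow_conj_mem {x : BraidGroup n} (hx : x ∈ PosBraid n) (j : ℤ) :
    (braidDelta n ^ j)⁻¹ * x * braidDelta n ^ j ∈ PosBraid n := by
  induction j using Int.induction_on with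
  | zero => simpa using hx
  | succ j ih =>
    have h := braidDelta_inv_conj_mem ih
    rwa [zpow_add_one, mul_inv_rev, ← mul_assoc, mul_assoc _ _ x, mul_assoc _ (_ * x)]
  | pred j ih =>
    have h := braidDelta_conj_mem ih
    rwa [zpow_sub_one, mul_inv_rev, inv_inv, ← mul_assoc, mul_assoc _ _ x, mul_assoc _ (_ * x)]

theorem PrefixLE.zpow_conj {a b : BraidGroup n} (h : PrefixLE n a b) (j : ℤ) :
    PrefixLE n ((braidDelta n ^ j)⁻¹ * a * braidDelta n ^ j)
      ((braidDelta n ^ j)⁻¹ * b * braidDelta n ^ j) := by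
  obtain ⟨c, hc, rfl⟩ := h
  exact ⟨_, braidDelta_zpow_conj_mem hc j, by simp [mul_assoc]⟩

/-- Every braid becomes positive after multiplication by a central power of the half-twist. -/
theorem exists_braidDelta_pow_mul_mem (b : BraidGroup n) :
    ∃ k : ℕ, (braidDelta n ^ 2) ^ k * b ∈ PosBraid n := by
  have hc : ∀ (k : ℕ) (x : BraidGroup n),
      (braidDelta n ^ 2) ^ k * x = x * (braidDelta n ^ 2) ^ k :=
    fun k x => ((braidDelta_sq_commute x).pow_left k).eq
  have hmul : ∀ x y : BraidGroup n, (∃ k : ℕ, (braidDelta n ^ 2) ^ k * x ∈ PosBraid n) →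
      (∃ k : ℕ, (braidDelta n ^ 2) ^ k * y ∈ PosBraid n) →
      ∃ k : ℕ, (braidDelta n ^ 2) ^ k * (x * y) ∈ PosBraid n := by
    rintro x y ⟨k, hk⟩ ⟨l, hl⟩
    refine ⟨l + k, ?_⟩
    have h := mul_mem hk hl
    rwa [mul_assoc, ← mul_assoc x, ← hc l x, mul_assoc, ← mul_assoc, ← pow_add, add_comm] at h
  let H : Subgroup (BraidGroup n) :=
    { carrier := {b | (∃ k : ℕ, (braidDelta n ^ 2) ^ k * b ∈ PosBraid n) ∧
        ∃ k : ℕ, (braidDelta n ^ 2) ^ k * b⁻¹ ∈ PosBraid n}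
      one_mem' := ⟨⟨0, by simp⟩, ⟨0, by simp⟩⟩
      mul_mem' := fun {x y} hx hy =>
        ⟨hmul x y hx.1 hy.1, by rw [mul_inv_rev]; exact hmul _ _ hy.2 hx.2⟩
      inv_mem' := fun {x} hx => ⟨hx.2, by rw [inv_inv]; exact hx.1⟩ }
  refine (PresentedGroup.generated_by (braidRels n) H (fun i => ⟨⟨0, ?_⟩, ⟨1, ?_⟩⟩) b).1
  · rw [pow_zero, one_mul]
    exact Submonoid.subset_closure ⟨i, rfl⟩
  · rw [hc, pow_one, pow_two, ← mul_assoc]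
    exact mul_mem (prefixLE_iff.1 (braidGen_prefixLE_braidDelta i)) braidDelta_mem

theorem InfGE.mono {j k : ℤ} (hjk : j ≤ k) {a : BraidGroup n} (h : InfGE n k a) :
    InfGE n j a := by
  obtain ⟨p, hp, rfl⟩ := h
  obtain ⟨m, rfl⟩ := Int.le.dest hjk
  exact ⟨braidDelta n ^ m * p, mul_mem (pow_mem braidDelta_mem m) hp, by
    rw [zpow_add, zpow_natCast, mul_assoc]⟩

/-- If conjugation by a positive braid does not decrease the infimum below `j`, neither does
conjugation by its greatest common prefix with the half-twist. -/
theorem InfGE.conj_of_isGCD {j : ℤ} {a w t : BraidGroup n} (ht : IsGCD n w (braidDelta n) t)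
    (hw : w ∈ PosBraid n) (ha : InfGE n j a) (haw : InfGE n j (w⁻¹ * a * w)) :
    InfGE n j (t⁻¹ * a * t) := by
  obtain ⟨p, hp, rfl⟩ := ha
  obtain ⟨q, hq, hpq⟩ := haw
  have hu := ht.prefixLE_mul hw braidDelta_mem hp (braidDelta_zpow_conj_mem ht.1 j) ?_ ?_
  · refine ⟨_, prefixLE_iff.1 hu, ?_⟩
    simp [mul_assoc]
  · refine (ht.2.1.zpow_conj j).trans ⟨q, hq, ?_⟩
    rw [mul_assoc, ← hpq]
    simp [mul_assoc]
  · refine (ht.2.2.1.zpow_conj j).trans ?_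
    rw [mul_assoc, ← zpow_one_add, add_comm, zpow_add_one, inv_mul_cancel_left, prefixLE_iff,
      ← mul_assoc]
    exact braidDelta_inv_conj_mem hp

/-- A nontrivial positive braid conjugating a tuple of `C_J` into `C_J` has a prefix which is
minimal among the nontrivial simple elements with this property. -/
theorem exists_minSimple_dvd {r : ℕ} {J : Fin r → ℤ} {δ : Fin r → BraidGroup n}
    {x : BraidMonoid n} (hx : x ≠ 1) (hδ : CJ n r J δ) (hxδ : PropP n r J δ (toBraid n x)) :
    ∃ y, y ∣ x ∧ y ≠ 1 ∧ MinSimple n r J δ (toBraid n y) := by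
  have hne : ∀ {y : BraidMonoid n}, y ≠ 1 → toBraid n y ≠ 1 := fun hy h =>
    hy (toBraid_injective n (h.trans (map_one _).symm))
  have hpos : ∀ y : BraidMonoid n, toBraid n y ∈ PosBraid n := fun y =>
    mem_posBraid_iff.2 ⟨y, rfl⟩
  let P : ℕ → Prop := fun k => ∃ y : BraidMonoid n, y ∣ x ∧ y ≠ 1 ∧
    IsSimple n (toBraid n y) ∧ PropP n r J δ (toBraid n y) ∧ ArtinMonoid.len y = k
  have hP : ∃ k, P k := by
    obtain ⟨t, ht⟩ := exists_isGCD (hpos x) (braidDelta_mem (n := n))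
    obtain ⟨y, rfl⟩ := mem_posBraid_iff.1 ht.1
    refine ⟨_, y, prefixLE_toBraid_iff.1 ht.2.1, ?_, ⟨ht.1, ht.2.2.1⟩,
      fun i => (hδ i).conj_of_isGCD ht (hpos x) (hxδ i), rfl⟩
    rintro rfl
    obtain ⟨i, z, rfl⟩ := (ArtinMonoid.eq_one_or x).resolve_left hx
    have h := ht.2.2.2 _ (hpos (ArtinMonoid.gen _ i))
      (prefixLE_toBraid_iff.2 (Dvd.intro z rfl))
      (by rw [toBraid_gen]; exact braidGen_prefixLE_braidDelta i)
    have hlen := ArtinMonoid.len_le_of_dvd (prefixLE_toBraid_iff.1 h)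
    simp at hlen
  classical
  obtain ⟨y, hyx, hy, hys, hyP, hylen⟩ := Nat.find_spec hP
  refine ⟨y, hyx, hy, hys, hne hy, hyP, fun t ht ht1 htP hty => ?_⟩
  obtain ⟨z, rfl⟩ := mem_posBraid_iff.1 ht.1
  obtain ⟨e, rfl⟩ := prefixLE_toBraid_iff.1 hty
  have hmin := Nat.find_min' hP ⟨z, (Dvd.intro e rfl).trans hyx,
    fun h => ht1 (by rw [h, map_one]), ht, htP, rfl⟩
  rw [← hylen, ArtinMonoid.len_mul] at hmin
  rw [ArtinMonoid.eq_one_of_len (x := e) (by omega), mul_one]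

/-- Conjugation by a positive braid between tuples of `C_J` factors through minimal simple
elements. -/
theorem exists_minSimple_chain {r : ℕ} {J : Fin r → ℤ} (x : BraidMonoid n)
    (δ : Fin r → BraidGroup n) (hδ : CJ n r J δ) (hx : PropP n r J δ (toBraid n x)) :
    ∃ (k : ℕ) (A : Fin (k + 1) → Fin r → BraidGroup n) (s : Fin k → BraidGroup n),
      A 0 = δ ∧ A (Fin.last k) = (fun i => (toBraid n x)⁻¹ * δ i * toBraid n x) ∧
      (∀ j, CJ n r J (A j) ∧ ∃ ω, ∀ i, A j i = ω⁻¹ * δ i * ω) ∧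
      (∀ j : Fin k, MinSimple n r J (A j.castSucc) (s j) ∧
        ∀ i, (s j)⁻¹ * A j.castSucc i * s j = A j.succ i) := by
  induction hN : ArtinMonoid.len x using Nat.strong_induction_on generalizing x δ with
  | _ N ih =>
  by_cases hx1 : x = 1
  · subst hx1
    exact ⟨0, fun _ => δ, Fin.elim0, rfl, by simp, fun _ => ⟨hδ, 1, by simp⟩, fun j => j.elim0⟩
  obtain ⟨y, ⟨z, rfl⟩, hy1, hy⟩ := exists_minSimple_dvd hx1 hδ hx
  have hylen : ArtinMonoid.len y ≠ 0 := fun h => hy1 (ArtinMonoid.eq_one_of_len h)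
  have hconj : ∀ i, (toBraid n z)⁻¹ * ((toBraid n y)⁻¹ * δ i * toBraid n y) * toBraid n z =
      (toBraid n (y * z))⁻¹ * δ i * toBraid n (y * z) := fun i => by
    simp [mul_assoc]
  obtain ⟨k, A, s, hA0, hAk, hA, hs⟩ := ih (ArtinMonoid.len z)
    (by rw [← hN, ArtinMonoid.len_mul]; omega) z
    (fun i => (toBraid n y)⁻¹ * δ i * toBraid n y) hy.2.2.1
    (fun i => by rw [hconj]; exact hx i) rfl
  refine ⟨k + 1, Fin.cons δ A, Fin.cons (toBraid n y) s, rfl, ?_, ?_, ?_⟩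
  · rw [← Fin.succ_last, Fin.cons_succ, hAk]
    exact funext hconj
  · intro j
    cases j using Fin.cases with
    | zero => exact ⟨hδ, 1, by simp⟩
    | succ j =>
      obtain ⟨h, ω, hω⟩ := hA j
      exact ⟨h, toBraid n y * ω, fun i => by simp [hω, mul_assoc]⟩
  · intro j
    cases j using Fin.cases with
    | zero => exact ⟨hy, fun i => by simp [hA0]⟩
    | succ j => simpa [← Fin.succ_castSucc] using hs j

end BraidGroup

/-- with `J = (inf(a₁),…,inf(a_r))`, every `β ∈ C^inf(α)` is reachable
from `α` by a chain inside `C^inf(α)` in which successive tuples are conjugated by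
elements of `S_{αⱼ,J}`, i.e. by ≼-minimal nontrivial simple elements conjugating the
current tuple into `C_J`. -/
theorem stmt2 (n r : ℕ) (hn : 2 ≤ n) (α β : Fin r → BraidGroup n)
    (J : Fin r → ℤ) (hJ : ∀ i, IsGreatest {k : ℤ | InfGE n k (α i)} (J i))
    (hβ : CInf n r α β) :
    ∃ (k : ℕ) (A : Fin (k + 1) → Fin r → BraidGroup n) (s : Fin k → BraidGroup n),
      A 0 = α ∧ A (Fin.last k) = β ∧
      (∀ j, CInf n r α (A j)) ∧
      (∀ j : Fin k, MinSimple n r J (A j.castSucc) (s j) ∧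
        ∀ i, (s j)⁻¹ * A j.castSucc i * s j = A j.succ i) := by
  obtain ⟨hinf, ω, hω⟩ := hβ
  obtain ⟨m, hm⟩ := exists_braidDelta_pow_mul_mem ω
  obtain ⟨x, hx⟩ := mem_posBraid_iff.1 hm
  have hβx : ∀ i, β i = (toBraid n x)⁻¹ * α i * toBraid n x := fun i => by
    have hc := ((braidDelta_sq_commute (α i)).pow_left m).eq
    have hD : ((braidDelta n ^ 2) ^ m)⁻¹ * α i * (braidDelta n ^ 2) ^ m = α i := by
      rw [mul_assoc, ← hc, inv_mul_cancel_left]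
    rw [hω, hx, mul_inv_rev]
    conv_lhs => rw [← hD]
    simp only [mul_assoc]
  obtain ⟨k, A, s, hA0, hAk, hA, hs⟩ := exists_minSimple_chain x α (J := J)
    (fun i => (hJ i).1) (fun i => hβx i ▸ hinf i _ (hJ i).1)
  exact ⟨k, A, s, hA0, hAk.trans (funext fun i => (hβx i).symm),
    fun j => ⟨fun i l hl => ((hA j).1 i).mono ((hJ i).2 hl), (hA j).2⟩, hs⟩
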